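/- Let p, q, r be affinely independent points in the Euclidean plane ℝ², and let u = (p+r)/2 be the midpoint of pr. Then dist(p, aff{q,r}) > min( dist(p, aff{u,q}), dist(q, aff{p,r}) ). -/

import Mathlib

section InfDistLine

variable {V : Type*} [NormedAddCommGroup V] [InnerProductSpace ℝ V]

/-- The squared distance from a point to a line, times the squared length of a segment spanning the
line, is a Gram determinant. -/
theorem infDist_affineSpan_pair_sq_mul_norm_sq (x y z : V) :
    Metric.infDist x (affineSpan ℝ ({y, z} : Set V) : Set V) ^ 2 * ‖z - y‖ ^ 2 =
      ‖x - y‖ ^ 2 * ‖z - y‖ ^ 2 - inner ℝ (x - y) (z - y) ^ 2 := by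
  rcases eq_or_ne z y with rfl | hzy
  · simp
  have hpos : 0 < ‖z - y‖ := norm_pos_iff.2 (sub_ne_zero.2 hzy)
  have hdist (t : ℝ) : dist x (AffineMap.lineMap y z t) ^ 2 * ‖z - y‖ ^ 2 =
      ‖x - y‖ ^ 2 * ‖z - y‖ ^ 2 - inner ℝ (x - y) (z - y) ^ 2 +
        (t * ‖z - y‖ ^ 2 - inner ℝ (x - y) (z - y)) ^ 2 := by
    have h : x - AffineMap.lineMap y z t = (x - y) - t • (z - y) := by
      rw [AffineMap.lineMap_apply, vsub_eq_sub, vadd_eq_add]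
      abel
    rw [dist_eq_norm, h, norm_sub_sq_real, real_inner_smul_right, norm_smul, mul_pow,
      Real.norm_eq_abs, sq_abs]
    ring
  set s : ℝ := inner ℝ (x - y) (z - y) / ‖z - y‖ ^ 2 with hs
  have hs0 : s * ‖z - y‖ ^ 2 - inner ℝ (x - y) (z - y) = 0 := by
    rw [hs]
    field_simp
    ring
  have hfoot : Metric.infDist x (affineSpan ℝ ({y, z} : Set V) : Set V) =
      dist x (AffineMap.lineMap y z s) := by
    refine le_antisymm
      (Metric.infDist_le_dist_of_mem (AffineMap.lineMap_mem_affineSpan_pair s y z)) ?_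
    refine (Metric.le_infDist ⟨y, left_mem_affineSpan_pair ℝ y z⟩).2 fun w hw ↦ ?_
    obtain ⟨t, rfl⟩ := mem_affineSpan_pair_iff_exists_lineMap_eq.1 hw
    refine (sq_le_sq₀ dist_nonneg dist_nonneg).1 ?_
    refine le_of_mul_le_mul_right ?_ (pow_pos hpos 2)
    rw [hdist, hdist, hs0]
    nlinarith [sq_nonneg (t * ‖z - y‖ ^ 2 - inner ℝ (x - y) (z - y))]
  rw [hfoot, hdist, hs0]
  ring

end InfDistLine

theorem AffineIndependent.infDist_affineSpan_pair_pos {V : Type*} [NormedAddCommGroup V]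
    [InnerProductSpace ℝ V] {p q r : V} (h : AffineIndependent ℝ ![p, q, r]) :
    0 < Metric.infDist p (affineSpan ℝ ({q, r} : Set V) : Set V) := by
  have hclosed : IsClosed (affineSpan ℝ ({q, r} : Set V) : Set V) :=
    AffineSubspace.closed_of_finiteDimensional _
  refine (hclosed.notMem_iff_infDist_pos ⟨q, left_mem_affineSpan_pair ℝ q r⟩).1 fun hp ↦ ?_
  exact affineIndependent_iff_not_collinear_set.1 h (collinear_insert_of_mem_affineSpan_pair hp)

theorem stmt_7 (p q r : EuclideanSpace ℝ (Fin 2))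
    (hind : AffineIndependent ℝ ![p, q, r])
    (u : EuclideanSpace ℝ (Fin 2)) (hu : u = midpoint ℝ p r) :
    Metric.infDist p (affineSpan ℝ ({q, r} : Set (EuclideanSpace ℝ (Fin 2))) : Set _) >
      min (Metric.infDist p (affineSpan ℝ ({u, q} : Set (EuclideanSpace ℝ (Fin 2))) : Set _))
          (Metric.infDist q (affineSpan ℝ ({p, r} : Set (EuclideanSpace ℝ (Fin 2))) : Set _)) := by
  have hd := hind.infDist_affineSpan_pair_pos
  have hpq : 0 < ‖q - p‖ :=
    norm_pos_iff.2 (sub_ne_zero.2 (hind.injective.ne (by decide : (1 : Fin 3) ≠ 0)))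
  have h₁ := infDist_affineSpan_pair_sq_mul_norm_sq p q r
  have h₂ := infDist_affineSpan_pair_sq_mul_norm_sq p u q
  have h₃ := infDist_affineSpan_pair_sq_mul_norm_sq q p r
  obtain ⟨a, ha⟩ : ∃ a, a = r - u := ⟨_, rfl⟩
  obtain ⟨b, hb⟩ : ∃ b, b = q - u := ⟨_, rfl⟩
  have hpu : p - u = -a := by
    rw [ha, hu, midpoint_eq_smul_add, invOf_eq_inv]
    module
  have hrq : r - q = a - b := by rw [ha, hb]; abel
  have hpq' : p - q = -(a + b) := by rw [← sub_sub_sub_cancel_right p q u, hpu, ← hb]; abel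
  have hqp : q - p = a + b := by rw [← neg_sub, hpq', neg_neg]
  have hrp : r - p = (2 : ℝ) • a := by
    rw [← sub_sub_sub_cancel_right r p u, hpu, ← ha]
    module
  rw [hqp] at hpq
  rw [hrq, hpq'] at h₁
  rw [hpu, ← hb] at h₂
  rw [hqp, hrp] at h₃
  simp only [norm_neg, inner_neg_left, norm_add_sq_real, norm_sub_sq_real, inner_add_left,
    inner_sub_right, real_inner_smul_right, norm_smul, mul_pow, real_inner_self_eq_norm_sq,
    real_inner_comm a b, Real.norm_ofNat] at h₁ h₂ h₃
  have hsum : 0 < ‖a‖ ^ 2 + 2 * inner ℝ a b + ‖b‖ ^ 2 := by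
    rw [← norm_add_sq_real]
    positivity
  by_contra! hle
  obtain ⟨hle₂, hle₃⟩ := le_min_iff.1 hle
  have k₂ := mul_le_mul_of_nonneg_right (pow_le_pow_left₀ hd.le hle₂ 2) (sq_nonneg ‖b‖)
  have k₃ := mul_le_mul_of_nonneg_right (pow_le_pow_left₀ hd.le hle₃ 2) (sq_nonneg ‖a‖)
  have k := mul_pos (pow_pos hd 2) hsum
  nlinarith
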